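/- Let A be a finite-dimensional algebra over a field F, let S_i and S_j be simple right A-modules with projective covers P_i and P_j respectively, and let n ≥ 1 be an integer. Then there is an F-linear isomorphism Hom_A(rad^{n-1}(P_i)/rad^n(P_i), ν(P_j)) ≅ Hom_A(P_i, soc^n(ν(P_j))/soc^{n-1}(ν(P_j))), where ν is the Nakayama functor. -/

import Mathlib

set_option linter.unusedSectionVars false
set_option synthInstance.maxHeartbeats 1000000
set_option maxHeartbeats 1000000

open Module MulOpposite

/-! ### Loewy-theoretic definitions: socle, radical, their iterates and layers -/

section LoewyDefs

variable (R : Type*) [Ring R]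

/-- The socle of a module: the sum of its minimal (= atomic) submodules. -/
def socSub (M : Type*) [AddCommGroup M] [Module R M] : Submodule R M :=
  sSup {m : Submodule R M | IsAtom m}

/-- The radical of a module: the intersection of its maximal (= coatomic) submodules. -/
def radSub (M : Type*) [AddCommGroup M] [Module R M] : Submodule R M :=
  sInf {m : Submodule R M | IsCoatom m}

/-- The `n`-th radical: `rad^0 M = M` and `rad^{n+1} M = rad (rad^n M)`,
viewed as a submodule of `M`. -/
def radPow (M : Type*) [AddCommGroup M] [Module R M] : ℕ → Submodule R M
  | 0 => ⊤
  | n + 1 => (radSub R (radPow M n)).map (radPow M n).subtype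

/-- The `n`-th socle: `soc^0 M = 0` and `soc^{n+1} M` is the preimage of
`soc (M / soc^n M)` under the canonical projection. -/
def socPow (M : Type*) [AddCommGroup M] [Module R M] : ℕ → Submodule R M
  | 0 => ⊥
  | n + 1 => (socSub R (M ⧸ socPow M n)).comap (socPow M n).mkQ

/-- The `n`-th radical layer `rad_n M = rad^{n-1} M / rad^n M`. -/
abbrev radLayer (M : Type*) [AddCommGroup M] [Module R M] (n : ℕ) :=
  ↥(radPow R M (n - 1)) ⧸ (radPow R M n).comap (radPow R M (n - 1)).subtype

/-- The `n`-th socle layer `soc_n M = soc^n M / soc^{n-1} M`. -/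
abbrev socLayer (M : Type*) [AddCommGroup M] [Module R M] (n : ℕ) :=
  ↥(socPow R M n) ⧸ (socPow R M (n - 1)).comap (socPow R M n).subtype

/-- The `n`-th capital `cap^n M = M / rad^n M`. -/
abbrev capital (M : Type*) [AddCommGroup M] [Module R M] (n : ℕ) :=
  M ⧸ radPow R M n

end LoewyDefs

/-! ### Contragredient dual module structures -/

section DualMod
variable (F A : Type*) [Field F] [Ring A] [Algebra F A]

/-- Contragredient action: the `F`-dual of a right `A`-module is a left `A`-module,
via `(a • l) m = l (op a • m)`. -/
noncomputable instance dualModuleOfRight (M : Type*) [AddCommGroup M] [Module F M]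
    [Module Aᵐᵒᵖ M] [SMulCommClass Aᵐᵒᵖ F M] : Module A (Module.Dual F M) where
  smul a l := l.comp (DistribMulAction.toLinearMap F M (op a))
  one_smul l := LinearMap.ext fun m => congrArg l (one_smul Aᵐᵒᵖ m)
  mul_smul a b l := LinearMap.ext fun m => congrArg l (mul_smul (op b) (op a) m)
  smul_zero a := rfl
  smul_add a l₁ l₂ := rfl
  add_smul a b l := LinearMap.ext fun m => by
    rw [LinearMap.add_apply]
    show l (op (a + b) • m) = l (op a • m) + l (op b • m)
    rw [← map_add]
    congr 1
    show (op a + op b) • m = _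
    rw [add_smul]
  zero_smul l := LinearMap.ext fun m => by
    show l ((0 : Aᵐᵒᵖ) • m) = 0
    rw [zero_smul, map_zero]

@[simp] lemma dualModuleOfRight_smul_apply (M : Type*) [AddCommGroup M] [Module F M]
    [Module Aᵐᵒᵖ M] [SMulCommClass Aᵐᵒᵖ F M] (a : A) (l : Module.Dual F M) (m : M) :
    (a • l) m = l (op a • m) := rfl

/-- Contragredient action: the `F`-dual of a left `A`-module is a right `A`-module,
via `(a • l) m = l (a.unop • m)`. -/
noncomputable instance dualModuleOfLeft (N : Type*) [AddCommGroup N] [Module F N]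
    [Module A N] [SMulCommClass A F N] : Module Aᵐᵒᵖ (Module.Dual F N) where
  smul a l := l.comp (DistribMulAction.toLinearMap F N a.unop)
  one_smul l := LinearMap.ext fun m => congrArg l (one_smul A m)
  mul_smul a b l := LinearMap.ext fun m => congrArg l (mul_smul b.unop a.unop m)
  smul_zero a := rfl
  smul_add a l₁ l₂ := rfl
  add_smul a b l := LinearMap.ext fun m => by
    rw [LinearMap.add_apply]
    show l ((a + b).unop • m) = l (a.unop • m) + l (b.unop • m)
    rw [← map_add]
    congr 1
    show (a.unop + b.unop) • m = _
    rw [add_smul]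
  zero_smul l := LinearMap.ext fun m => by
    show l ((0 : A) • m) = 0
    rw [zero_smul, map_zero]

@[simp] lemma dualModuleOfLeft_smul_apply (N : Type*) [AddCommGroup N] [Module F N]
    [Module A N] [SMulCommClass A F N] (a : Aᵐᵒᵖ) (l : Module.Dual F N) (m : N) :
    (a • l) m = l (a.unop • m) := rfl

noncomputable instance dualTowerOfRight (M : Type*) [AddCommGroup M] [Module F M]
    [Module Aᵐᵒᵖ M] [IsScalarTower F Aᵐᵒᵖ M] : IsScalarTower F A (Module.Dual F M) where
  smul_assoc c a l := LinearMap.ext fun m => by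
    show l (op (c • a) • m) = c • l (op a • m)
    rw [← map_smul]
    congr 1
    show (c • op a) • m = c • op a • m
    rw [smul_assoc]

noncomputable instance dualTowerOfLeft (N : Type*) [AddCommGroup N] [Module F N]
    [Module A N] [IsScalarTower F A N] : IsScalarTower F Aᵐᵒᵖ (Module.Dual F N) where
  smul_assoc c a l := LinearMap.ext fun m => by
    show l ((c • a).unop • m) = c • l (a.unop • m)
    rw [← map_smul]
    congr 1
    show (c • a.unop) • m = c • a.unop • m
    rw [smul_assoc]

end DualMod

section Semiprimary

variable {R : Type*} [Ring R] [IsSemiprimaryRing R]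

/-- Over a semiprimary ring, a module annihilated by the Jacobson radical is semisimple. -/
lemma isSemisimpleModule_of_jacobson_le_annihilator {M : Type*} [AddCommGroup M] [Module R M]
    (h : Ring.jacobson R ≤ Module.annihilator R M) : IsSemisimpleModule R M := by
  rw [← SetLike.coe_subset_coe, ← Module.isTorsionBySet_iff_subset_annihilator] at h
  let _ := h.module
  exact (h.semilinearMap.isSemisimpleModule_iff_of_bijective Function.bijective_id).2
    inferInstance

lemma radSub_eq_jacobson_smul_top (M : Type*) [AddCommGroup M] [Module R M] :
    radSub R M = Ring.jacobson R • (⊤ : Submodule R M) := by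
  refine le_antisymm (Module.jacobson_le_of_eq_bot ?_) (Ring.jacobson_smul_top_le R M)
  have : IsSemisimpleModule R (M ⧸ Ring.jacobson R • (⊤ : Submodule R M)) := by
    apply isSemisimpleModule_of_jacobson_le_annihilator
    rw [← SetLike.coe_subset_coe, ← Module.isTorsionBySet_iff_subset_annihilator,
      Module.isTorsionBySet_quotient_iff]
    exact fun m i hi ↦ Submodule.smul_mem_smul hi trivial
  exact IsSemisimpleModule.jacobson_eq_bot R _

lemma mem_socSub_iff {M : Type*} [AddCommGroup M] [Module R M] {x : M} :
    x ∈ socSub R M ↔ ∀ j ∈ Ring.jacobson R, j • x = 0 := by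
  constructor
  · intro hx j hj
    have : IsSemisimpleModule R (socSub R M) := by
      rw [socSub, sSup_eq_iSup]
      exact isSemisimpleModule_biSup_of_isSemisimpleModule_submodule (p := id) fun m hm ↦
        have : IsSimpleModule R m := isSimpleModule_iff_isAtom.2 hm
        inferInstanceAs (IsSemisimpleModule R m)
    have hann := IsSemisimpleModule.jacobson_le_annihilator R (socSub R M) hj
    exact congrArg Subtype.val (Module.mem_annihilator.1 hann ⟨x, hx⟩)
  · intro hx
    have hspan : Ring.jacobson R ≤ Module.annihilator R (Submodule.span R {x}) := by
      refine fun j hj ↦ Module.mem_annihilator.2 fun ⟨y, hy⟩ ↦ Subtype.ext ?_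
      obtain ⟨r, rfl⟩ := Submodule.mem_span_singleton.1 hy
      show j • r • x = 0
      rw [← mul_smul]
      exact hx _ (Ideal.mul_mem_right r _ hj)
    have := isSemisimpleModule_of_jacobson_le_annihilator hspan
    have hle : Submodule.span R {x} ≤ socSub R M := by
      conv_lhs => rw [← Submodule.map_subtype_top (Submodule.span R {x}),
        ← IsSemisimpleModule.sSup_simples_eq_top, sSup_eq_iSup, Submodule.map_iSup]
      refine iSup_le fun m ↦ ?_
      rw [Submodule.map_iSup]
      refine iSup_le fun (hm : IsSimpleModule R m) ↦ le_sSup ?_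
      exact isSimpleModule_iff_isAtom.1 (IsSimpleModule.congr
        (m.equivMapOfInjective _ (Submodule.injective_subtype _)).symm)
    exact hle (Submodule.mem_span_singleton_self x)

lemma radPow_eq_jacobson_pow_smul_top (M : Type*) [AddCommGroup M] [Module R M] (n : ℕ) :
    radPow R M n = Ring.jacobson R ^ n • (⊤ : Submodule R M) := by
  induction n with
  | zero => rw [Submodule.pow_zero, Submodule.one_smul]; rfl
  | succ n ih =>
    rw [radPow, radSub_eq_jacobson_smul_top, Submodule.map_smul'', Submodule.map_subtype_top, ih,
      ← Submodule.mul_smul, ← Ideal.IsTwoSided.pow_succ]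

lemma mem_socPow_iff {M : Type*} [AddCommGroup M] [Module R M] {n : ℕ} {x : M} :
    x ∈ socPow R M n ↔ ∀ j ∈ Ring.jacobson R ^ n, j • x = 0 := by
  induction n generalizing x with
  | zero =>
    refine ⟨fun h j _ ↦ ?_, fun h ↦ ?_⟩
    · rw [(Submodule.mem_bot R).1 h, smul_zero]
    · have := h 1 (by rw [Submodule.pow_zero, Ideal.one_eq_top]; trivial)
      rwa [one_smul] at this
  | succ n ih =>
    rw [socPow, Submodule.mem_comap, mem_socSub_iff]
    simp_rw [← map_smul, Submodule.mkQ_apply, Submodule.Quotient.mk_eq_zero, ih, ← mul_smul]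
    refine ⟨fun h j hj ↦ ?_, fun h j hj k hk ↦ h _ ?_⟩
    · rw [Submodule.pow_succ] at hj
      induction hj using Submodule.smul_induction_on' with
      | smul k hk j hj => exact h j hj k hk
      | add a _ b _ ha hb => rw [add_smul, ha, hb, add_zero]
    · rw [Submodule.pow_succ]
      exact Ideal.mul_mem_mul hk hj

/-- A linear map kills the `n`-th radical iff it takes values in the `n`-th socle. -/
lemma radPow_le_ker_iff_range_le_socPow {M N : Type*} [AddCommGroup M] [Module R M]
    [AddCommGroup N] [Module R N] (f : M →ₗ[R] N) (n : ℕ) :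
    radPow R M n ≤ LinearMap.ker f ↔ LinearMap.range f ≤ socPow R N n := by
  rw [radPow_eq_jacobson_pow_smul_top, Submodule.smul_le, LinearMap.range_le_iff_comap,
    Submodule.eq_top_iff']
  simp only [Submodule.mem_comap, mem_socPow_iff, LinearMap.mem_ker, map_smul]
  exact ⟨fun h x j hj ↦ h j hj x trivial, fun h j hj x _ ↦ h x j hj⟩

end Semiprimary

/-- Two surjective linear maps with the same kernel have isomorphic codomains. -/
lemma nonempty_linearEquiv_of_ker_eq {K V W₁ W₂ : Type*} [Ring K] [AddCommGroup V] [Module K V]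
    [AddCommGroup W₁] [Module K W₁] [AddCommGroup W₂] [Module K W₂]
    (f : V →ₗ[K] W₁) (g : V →ₗ[K] W₂) (hf : Function.Surjective f) (hg : Function.Surjective g)
    (h : LinearMap.ker f = LinearMap.ker g) : Nonempty (W₁ ≃ₗ[K] W₂) :=
  ⟨(f.quotKerEquivOfSurjective hf).symm ≪≫ₗ Submodule.quotEquivOfEq _ _ h ≪≫ₗ
    g.quotKerEquivOfSurjective hg⟩

section LayerHom

variable {F R : Type*} [Field F] [Ring R] [Algebra F R] [IsSemiprimaryRing R]
  {M N : Type*} [AddCommGroup M] [Module R M]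
  [AddCommGroup N] [Module R N] [Module F N] [IsScalarTower F R N]

variable (F) in
/-- The `F`-space of linear maps killing the `n`-th radical. -/
def homKillingRadPow (M N : Type*) [AddCommGroup M] [Module R M]
    [AddCommGroup N] [Module R N] [Module F N] [IsScalarTower F R N] (n : ℕ) :
    Submodule F (M →ₗ[R] N) where
  carrier := {f | radPow R M n ≤ LinearMap.ker f}
  zero_mem' := fun x _ ↦ rfl
  add_mem' {f g} hf hg := fun x hx ↦ by
    have hf : f x = 0 := hf hx
    have hg : g x = 0 := hg hx
    show f x + g x = 0
    rw [hf, hg, add_zero]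
  smul_mem' c f hf := fun x hx ↦ by
    have hf : f x = 0 := hf hx
    show c • f x = 0
    rw [hf, smul_zero]

/-- Restriction of a map killing `rad^(n+1)` to the `(n+1)`-st radical layer. -/
def homRadLayerOfKilling (n : ℕ) :
    homKillingRadPow F (R := R) M N (n + 1) →ₗ[F] (radLayer R M (n + 1) →ₗ[R] N) where
  toFun f := Submodule.liftQ _ (f.1 ∘ₗ (radPow R M n).subtype) fun _ hx ↦ f.2 hx
  map_add' f g := by ext; rfl
  map_smul' c f := by ext; rfl

/-- The map to the `(n+1)`-st socle layer induced by a map killing `rad^(n+1)`. -/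
def homSocLayerOfKilling (n : ℕ) :
    homKillingRadPow F (R := R) M N (n + 1) →ₗ[F] (M →ₗ[R] socLayer R N (n + 1)) where
  toFun f := Submodule.mkQ _ ∘ₗ f.1.codRestrict (socPow R N (n + 1)) fun x ↦
    (radPow_le_ker_iff_range_le_socPow f.1 _).1 f.2 (LinearMap.mem_range_self f.1 x)
  map_add' f g := by ext; rfl
  map_smul' c f := by ext; rfl

lemma ker_homRadLayerOfKilling (n : ℕ) :
    LinearMap.ker (homRadLayerOfKilling (F := F) (R := R) (M := M) (N := N) n) =
      LinearMap.ker (homSocLayerOfKilling n) := by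
  ext f
  have h₁ : f ∈ LinearMap.ker (homRadLayerOfKilling n) ↔
      radPow R M n ≤ LinearMap.ker f.1 := by
    rw [LinearMap.mem_ker]
    refine ⟨fun h x hx ↦ ?_, fun h ↦ ?_⟩
    · exact LinearMap.congr_fun h (Submodule.Quotient.mk (⟨x, hx⟩ : radPow R M n))
    · ext x
      exact h x.2
  have h₂ : f ∈ LinearMap.ker (homSocLayerOfKilling n) ↔
      LinearMap.range f.1 ≤ socPow R N n := by
    rw [LinearMap.mem_ker]
    refine ⟨?_, fun h ↦ ?_⟩
    · rintro h _ ⟨x, rfl⟩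
      exact (Submodule.Quotient.mk_eq_zero
        ((socPow R N n).comap (socPow R N (n + 1)).subtype)).1 (LinearMap.congr_fun h x)
    · ext x
      exact (Submodule.Quotient.mk_eq_zero _).2 (h ⟨x, rfl⟩)
  rw [h₁, h₂, radPow_le_ker_iff_range_le_socPow]

lemma homRadLayerOfKilling_surjective
    (hext : ∀ (X : Submodule R M) (g : X →ₗ[R] N), ∃ f : M →ₗ[R] N, f ∘ₗ X.subtype = g) (n : ℕ) :
    Function.Surjective (homRadLayerOfKilling (F := F) (R := R) (M := M) (N := N) n) := by
  intro g
  obtain ⟨f, hf⟩ := hext (radPow R M n) (g ∘ₗ Submodule.mkQ _)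
  have hle : radPow R M (n + 1) ≤ radPow R M n := Submodule.map_subtype_le _ _
  refine ⟨⟨f, fun x hx ↦ ?_⟩, ?_⟩
  · refine (LinearMap.congr_fun hf ⟨x, hle hx⟩).trans ?_
    refine (congrArg g ((Submodule.Quotient.mk_eq_zero _).2 ?_)).trans (map_zero g)
    exact hx
  · ext x
    exact LinearMap.congr_fun hf x

lemma homSocLayerOfKilling_surjective [Module.Projective R M] (n : ℕ) :
    Function.Surjective (homSocLayerOfKilling (F := F) (R := R) (M := M) (N := N) n) := by
  intro g
  obtain ⟨f, hf⟩ := Module.projective_lifting_property _ g (Submodule.mkQ_surjective _)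
  refine ⟨⟨(socPow R N (n + 1)).subtype ∘ₗ f, ?_⟩, ?_⟩
  · refine (radPow_le_ker_iff_range_le_socPow _ _).2 ?_
    rintro _ ⟨x, rfl⟩
    exact (f x).2
  · ext x
    exact LinearMap.congr_fun hf x

/-- If `M` is projective and maps to `N` extend from submodules of `M`, then maps from a radical
layer of `M` to `N` correspond to maps from `M` to the corresponding socle layer of `N`. -/
lemma nonempty_homRadLayer_equiv_homSocLayer [Module.Projective R M]
    (hext : ∀ (X : Submodule R M) (g : X →ₗ[R] N), ∃ f : M →ₗ[R] N, f ∘ₗ X.subtype = g) (n : ℕ) :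
    Nonempty ((radLayer R M (n + 1) →ₗ[R] N) ≃ₗ[F] (M →ₗ[R] socLayer R N (n + 1))) :=
  nonempty_linearEquiv_of_ker_eq _ _ (homRadLayerOfKilling_surjective hext n)
    (homSocLayerOfKilling_surjective n) (ker_homRadLayerOfKilling n)

end LayerHom

section NakayamaInjective

variable {F A : Type*} [Field F] [Ring A] [Algebra F A]

/-- The `A`-dual of a finitely generated projective right module is a projective left module. -/
lemma projective_hom_self (P : Type*) [AddCommGroup P] [Module Aᵐᵒᵖ P]
    [Module.Finite Aᵐᵒᵖ P] [Module.Projective Aᵐᵒᵖ P] :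
    Module.Projective A (P →ₗ[Aᵐᵒᵖ] A) := by
  obtain ⟨n, f, g, -, -, hfg⟩ := Module.Finite.exists_comp_eq_id_of_projective Aᵐᵒᵖ P
  let i : (P →ₗ[Aᵐᵒᵖ] A) →ₗ[A] (Fin n → A) :=
    { toFun φ k := φ (f (Pi.single k 1))
      map_add' _ _ := rfl
      map_smul' _ _ := rfl }
  let s : (Fin n → A) →ₗ[A] (P →ₗ[Aᵐᵒᵖ] A) :=
    { toFun v :=
        { toFun p := ∑ k, g p k • v k
          map_add' p q := by simp [mul_add, Finset.sum_add_distrib]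
          map_smul' c p := by simp [Finset.sum_mul, mul_assoc] }
      map_add' v w := by ext p; simp [Finset.sum_add_distrib]
      map_smul' c v := by ext p; simp [Finset.mul_sum, mul_assoc] }
  refine Module.Projective.of_split i s (LinearMap.ext fun φ ↦ LinearMap.ext fun p ↦ ?_)
  show ∑ k, g p k • φ (f (Pi.single k 1)) = φ p
  simp_rw [← map_smul, ← map_sum]
  congr 1
  rw [← pi_eq_sum_univ' (g p)]
  exact LinearMap.congr_fun hfg p

/-- The `F`-dual of a projective left module is an injective right module. -/
lemma exists_extension_to_dual {N M : Type*} [AddCommGroup N] [Module A N] [Module F N]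
    [IsScalarTower F A N] [Module.Projective A N]
    [AddCommGroup M] [Module Aᵐᵒᵖ M] [Module F M] [IsScalarTower F Aᵐᵒᵖ M]
    (X : Submodule Aᵐᵒᵖ M) (g : X →ₗ[Aᵐᵒᵖ] Module.Dual F N) :
    ∃ f : M →ₗ[Aᵐᵒᵖ] Module.Dual F N, f ∘ₗ X.subtype = g := by
  have hg (c : F) (x : X) : g (c • x) = c • g x := map_smul (g.restrictScalars F) c x
  let res : Module.Dual F M →ₗ[A] Module.Dual F X :=
    { toFun l := l ∘ₗ (X.subtype.restrictScalars F)
      map_add' _ _ := rfl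
      map_smul' _ _ := rfl }
  have hres : Function.Surjective res := fun l ↦
    LinearMap.exists_extend (p := X.restrictScalars F) l
  let g' : N →ₗ[A] Module.Dual F X :=
    { toFun y :=
        { toFun x := g x y
          map_add' x₁ x₂ := by rw [map_add]; rfl
          map_smul' c x := by rw [hg]; rfl }
      map_add' y₁ y₂ := LinearMap.ext fun x ↦ map_add (g x) y₁ y₂
      map_smul' a y := LinearMap.ext fun x ↦
        (LinearMap.congr_fun (map_smul g (op a) x) y).symm }
  obtain ⟨h, hh⟩ := Module.projective_lifting_property res g' hres
  have hsmul (c : F) (y : N) : h (c • y) = c • h y := map_smul (h.restrictScalars F) c y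
  refine ⟨
    { toFun x :=
        { toFun y := h y x
          map_add' y₁ y₂ := by rw [map_add]; rfl
          map_smul' c y := by rw [hsmul]; rfl }
      map_add' x₁ x₂ := LinearMap.ext fun y ↦ map_add (h y) x₁ x₂
      map_smul' a x := LinearMap.ext fun y ↦
        (LinearMap.congr_fun (map_smul h a.unop y) x).symm }, ?_⟩
  exact LinearMap.ext fun x ↦ LinearMap.ext fun y ↦
    LinearMap.congr_fun (LinearMap.congr_fun hh y) x

end NakayamaInjective

/-- For a finite dimensional algebra `A` over a field `F`, projective covers `Pi`, `Pj` of
simple right `A`-modules `Si`, `Sj`, and `n ≥ 1`, there is an `F`-linear isomorphism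
`Hom_A(rad^{n-1} Pi / rad^n Pi, ν Pj) ≅ Hom_A(Pi, soc^n (ν Pj) / soc^{n-1} (ν Pj))`,
where `ν = Hom_F(Hom_A(-, A), F)` is the Nakayama functor.
Right `A`-modules are rendered as left modules over `Aᵐᵒᵖ`. -/
theorem hom_radLayer_nakayama_iso_hom_socLayer_nakayama
    (F A : Type*) [Field F] [Ring A] [Algebra F A] [FiniteDimensional F A]
    (Si Sj Pi Pj : Type*)
    [AddCommGroup Si] [Module Aᵐᵒᵖ Si] [Module F Si] [IsScalarTower F Aᵐᵒᵖ Si]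
    [IsSimpleModule Aᵐᵒᵖ Si] [Module.Finite Aᵐᵒᵖ Si]
    [AddCommGroup Sj] [Module Aᵐᵒᵖ Sj] [Module F Sj] [IsScalarTower F Aᵐᵒᵖ Sj]
    [IsSimpleModule Aᵐᵒᵖ Sj] [Module.Finite Aᵐᵒᵖ Sj]
    [AddCommGroup Pi] [Module Aᵐᵒᵖ Pi] [Module F Pi] [IsScalarTower F Aᵐᵒᵖ Pi]
    [Module.Finite Aᵐᵒᵖ Pi] [Module.Projective Aᵐᵒᵖ Pi]
    [AddCommGroup Pj] [Module Aᵐᵒᵖ Pj] [Module F Pj] [IsScalarTower F Aᵐᵒᵖ Pj]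
    [Module.Finite Aᵐᵒᵖ Pj] [Module.Projective Aᵐᵒᵖ Pj]
    (πi : Pi →ₗ[Aᵐᵒᵖ] Si) (hsi : Function.Surjective πi)
    (hki : LinearMap.ker πi ≤ radSub Aᵐᵒᵖ Pi)
    (πj : Pj →ₗ[Aᵐᵒᵖ] Sj) (hsj : Function.Surjective πj)
    (hkj : LinearMap.ker πj ≤ radSub Aᵐᵒᵖ Pj)
    (n : ℕ) (hn : 1 ≤ n) :
    Nonempty ((radLayer Aᵐᵒᵖ Pi n →ₗ[Aᵐᵒᵖ] Module.Dual F (Pj →ₗ[Aᵐᵒᵖ] A)) ≃ₗ[F]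
      (Pi →ₗ[Aᵐᵒᵖ] socLayer Aᵐᵒᵖ (Module.Dual F (Pj →ₗ[Aᵐᵒᵖ] A)) n)) := by
  obtain ⟨n, rfl⟩ := Nat.exists_eq_add_of_le' hn
  have : Module.Projective A (Pj →ₗ[Aᵐᵒᵖ] A) := projective_hom_self Pj
  have : IsArtinianRing Aᵐᵒᵖ := IsArtinianRing.of_finite F Aᵐᵒᵖ
  exact nonempty_homRadLayer_equiv_homSocLayer
    (fun X g ↦ exists_extension_to_dual X g) n
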